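/- Plücker-type quadratic relation (Theorem 4.2(1)): Let R be a commutative ring, N a positive integer, U an N×N upper unitriangular matrix over R, and r an integer. Let λ be a partition with n corners, written λ = (m_1^{r_1} m_2^{r_2−r_1} ⋯ m_n^{r_n−r_{n−1}}) with m_1 > ⋯ > m_n > 0 and 0 < r_1 < ⋯ < r_n, and assume r_n + 1 ≤ r − 1 and m_1 + 1 ≤ N − r. Fix 1 ≤ d ≤ n and set ℓ := r_d (the height of the d-th shortest column of λ). Then S^{(r)}_{λ}(U) · S^{(r−1)}_{λ}(U) = S^{(r)}_{λ−(1^ℓ)}(U) · S^{(r−1)}_{λ+(1^ℓ)}(U) + Σ_{t=1}^{min(d, n−d+1)} (−1)^{t−1} Σ_{1 ≤ p_1 < ⋯ < p_t ≤ d, d ≤ q_t < ⋯ < q_1 ≤ n} S^{(r)}_{add^{p_1,…,p_t}_{q_1,…,q_t}(λ)}(U) · S^{(r−1)}_{rem^{p_1,…,p_t}_{q_1,…,q_t}(λ)}(U). -/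

import Mathlib

open Matrix BigOperators Finset Filter

/-- Extend a `Fin N`-indexed matrix to `ℕ` indices by zero. -/
def matExt {R : Type*} [Zero R] {N : ℕ} (U : Matrix (Fin N) (Fin N) R) : ℕ → ℕ → R :=
  fun i j => if hi : i < N then (if hj : j < N then U ⟨i, hi⟩ ⟨j, hj⟩ else 0) else 0

/-- `U` is upper unitriangular. -/
def UpperUni {R : Type*} [Zero R] [One R] {N : ℕ} (U : Matrix (Fin N) (Fin N) R) : Prop :=
  (∀ i, U i i = 1) ∧ ∀ i j : Fin N, (j : ℕ) < (i : ℕ) → U i j = 0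

/-- `L` is lower unitriangular. -/
def LowerUni {R : Type*} [Zero R] [One R] {N : ℕ} (L : Matrix (Fin N) (Fin N) R) : Prop :=
  (∀ i, L i i = 1) ∧ ∀ i j : Fin N, (i : ℕ) < (j : ℕ) → L i j = 0

/-- 0-based entries of the Maya diagram `J(λ;r)` (the `a`-th smallest element, minus 1):
for `a = 0,…,r-1` this is `λ_{r-a} + a` (with `λ` 0-based). -/
def maya (lam : ℕ → ℕ) (r : ℕ) (a : Fin r) : ℕ := lam (r - 1 - (a : ℕ)) + (a : ℕ)

/-- The ninth variation of the skew Schur function `S^{(r)}_{λ/μ}(U)`: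
the minor of `U` on rows `J(μ;r)` and columns `J(λ;r)`. -/
def SchurV {R : Type*} [CommRing R] {N : ℕ} (U : Matrix (Fin N) (Fin N) R)
    (r : ℕ) (lam mu : ℕ → ℕ) : R :=
  Matrix.det (Matrix.of fun i j : Fin r => matExt U (maya mu r i) (maya lam r j))

/-- Conjugate partition (0-based), counting parts among indices `< B`. -/
def conjF (f : ℕ → ℕ) (B : ℕ) : ℕ → ℕ :=
  fun i => ((Finset.range B).filter fun j => i + 1 ≤ f j).card

/-- The hook partition `(a+1, 1^b)` (0-based function). -/
def hookP (a b : ℕ) : ℕ → ℕ := fun k => if k = 0 then a + 1 else if k ≤ b then 1 else 0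

/-- `h^{(r)}_d(U) = S^{(r)}_{(d)}(U)`, zero for `d < 0`. -/
def hSV {R : Type*} [CommRing R] {N : ℕ} (U : Matrix (Fin N) (Fin N) R) (r : ℕ) (d : ℤ) : R :=
  if 0 ≤ d then SchurV U r (fun k => if k = 0 then d.toNat else 0) (fun _ => 0) else 0

/-- `e^{(r)}_d(U) = S^{(r)}_{(1^d)}(U)`, zero for `d < 0`. -/
def eSV {R : Type*} [CommRing R] {N : ℕ} (U : Matrix (Fin N) (Fin N) R) (r : ℕ) (d : ℤ) : R :=
  if 0 ≤ d then SchurV U r (fun k => if k < d.toNat then 1 else 0) (fun _ => 0) else 0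

/-- The partition with Frobenius coordinates `(a|b)` (all 0-based as functions). -/
def frobP (p : ℕ) (a b : Fin p → ℕ) : ℕ → ℕ :=
  fun i => if h : i < p then a ⟨i, h⟩ + i + 1
    else (Finset.univ.filter fun j : Fin p => i < b j + (j : ℕ) + 1).card

/-- `f : ℕ → ℤ` is a partition of length `≤ B`. -/
def IsPartZ (B : ℕ) (f : ℕ → ℤ) : Prop :=
  (∀ i, f (i + 1) ≤ f i) ∧ (∀ i, 0 ≤ f i) ∧ (∀ i, B ≤ i → f i = 0)

/-- `lam/mu` is a skew partition (of length `≤ B`). -/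
def IsSkewZ (B : ℕ) (lam mu : ℕ → ℤ) : Prop :=
  IsPartZ B lam ∧ IsPartZ B mu ∧ ∀ i, mu i ≤ lam i

open Classical in
/-- `S^{(r)}_{λ/μ}(U)` with the convention that it is `0` if `λ/μ` is not a skew partition. -/
noncomputable def SchurVz {R : Type*} [CommRing R] {N : ℕ} (U : Matrix (Fin N) (Fin N) R)
    (r B : ℕ) (lam mu : ℕ → ℤ) : R :=
  if IsSkewZ B lam mu then SchurV U r (fun i => (lam i).toNat) (fun i => (mu i).toNat) else 0

open Classical in
/-- `S^{(r)}_{λ'/μ'}(U)` applied to the conjugates, with the zero convention. -/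
noncomputable def SchurVzConj {R : Type*} [CommRing R] {N : ℕ} (U : Matrix (Fin N) (Fin N) R)
    (r B : ℕ) (lam mu : ℕ → ℤ) : R :=
  if IsSkewZ B lam mu then
    SchurV U r (conjF (fun i => (lam i).toNat) B) (conjF (fun i => (mu i).toNat) B) else 0

/-- `lam/mu` is a skew partition (ℕ-valued version). -/
def IsSkewN (B : ℕ) (lam mu : ℕ → ℕ) : Prop :=
  (∀ i, lam (i + 1) ≤ lam i) ∧ (∀ i, mu (i + 1) ≤ mu i) ∧ (∀ i, mu i ≤ lam i) ∧
    (∀ i, B ≤ i → lam i = 0)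

open Classical in
noncomputable def SchurVn {R : Type*} [CommRing R] {N : ℕ} (U : Matrix (Fin N) (Fin N) R)
    (r B : ℕ) (lam mu : ℕ → ℕ) : R :=
  if IsSkewN B lam mu then SchurV U r lam mu else 0

/-- The rectangular partition `[m|n] = (n^m)`. -/
def rectP (m n : ℕ) : ℕ → ℕ := fun i => if i < m then n else 0

/-- `[m|n]^l = ((n+1)^l, n^{m-l})`. -/
def rectUpP (m n l : ℕ) : ℕ → ℕ := fun i => if i < l then n + 1 else if i < m then n else 0

/-- `[m|n]_k = (n^m, k)`. -/
def rectLowP (m n k : ℕ) : ℕ → ℕ := fun i => if i < m then n else if i = m then k else 0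

/-- `E + c·E_{t,t+1}` (indices 0-based). -/
def elemMat {R : Type*} [CommRing R] (N t : ℕ) (c : R) : Matrix (Fin N) (Fin N) R :=
  1 + Matrix.of (fun i j : Fin N => if (i : ℕ) = t ∧ (j : ℕ) = t + 1 then c else 0)

/-- `U = U_1 ⋯ U_M` with `U_k = (E + w_{k,1-r}E_{1,2}) ⋯ (E + w_{k,N-1-r}E_{N-1,N})`. -/
def UmatW {R : Type*} [CommRing R] (N M : ℕ) (r : ℤ) (w : ℕ → ℤ → R) :
    Matrix (Fin N) (Fin N) R :=
  ((List.range M).map fun k =>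
    ((List.range (N - 1)).map fun t => elemMat N t (w (k + 1) ((t : ℤ) + 1 - r))).prod).prod

/-- The partition `(m_1^{r_1} m_2^{r_2-r_1} ⋯ m_n^{r_n-r_{n-1}})` (corner data 0-based). -/
def stepPart (n : ℕ) (m rr : ℕ → ℕ) : ℕ → ℕ :=
  fun i =>
    if h : (((Finset.range n).filter fun j => i < rr j)).Nonempty then
      m (((Finset.range n).filter fun j => i < rr j).min' h)
    else 0

/-- `Add_{a,b}` (rows 1-based in `a`, `b`; the function argument is 0-based). -/
def AddOp (a b : ℕ) (k : ℕ → ℕ) : ℕ → ℕ := fun i =>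
  if i + 1 ≤ a then k i
  else if i + 1 = a + 1 then k (a - 1)
  else if i + 1 ≤ b + 1 then k (i - 1) + 1
  else k i

/-- `Rem_{a,b}`. -/
def RemOp (a b : ℕ) (k : ℕ → ℕ) : ℕ → ℕ := fun i =>
  if i + 1 < a then k i
  else if i + 1 ≤ b - 1 then k (i + 1) - 1
  else if i + 1 = b then k b
  else k i

/-- `op_{a 0, b 0} ∘ op_{a 1, b 1} ∘ ⋯ ∘ op_{a (t-1), b (t-1)}` applied to `k`. -/
def iterOp (op : ℕ → ℕ → (ℕ → ℕ) → ℕ → ℕ) (t : ℕ) (a b : ℕ → ℕ) (k : ℕ → ℕ) : ℕ → ℕ :=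
  (List.range t).foldr (fun i acc => op (a i) (b i) acc) k

/-- the `i`-th smallest element of a finite set of naturals (0-based). -/
def ascNth (s : Finset ℕ) (i : ℕ) : ℕ := (s.sort (· ≤ ·)).getD i 0

/-- The cells of the skew Young diagram `D(λ/μ)` (0-based, rows `< B`). -/
def cellsD (B : ℕ) (lam mu : ℕ → ℕ) : Finset (ℕ × ℕ) :=
  (Finset.range B ×ˢ Finset.range (lam 0 + 1)).filter fun p => mu p.1 ≤ p.2 ∧ p.2 < lam p.1

/-- Semistandardness: weakly increasing along rows, strictly increasing down columns. -/
def IsSSYT {M B : ℕ} {lam mu : ℕ → ℕ} (T : ↥(cellsD B lam mu) → Fin M) : Prop :=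
  (∀ c c' : ↥(cellsD B lam mu), c.val.1 = c'.val.1 → c.val.2 ≤ c'.val.2 → T c ≤ T c') ∧
  (∀ c c' : ↥(cellsD B lam mu), c.val.1 < c'.val.1 → c.val.2 = c'.val.2 → T c < T c')

open Classical in
/-- Sum over all semistandard tableaux of shape `λ/μ` with entries in `{1,…,M}` of
the product over cells `c` of `f (entry) c`. -/
noncomputable def tabSum {R : Type*} [CommRing R] (M B : ℕ) (lam mu : ℕ → ℕ)
    (f : ℕ → ℕ × ℕ → R) : R :=
  ∑ T ∈ Finset.univ.filter (fun T : ↥(cellsD B lam mu) → Fin M => IsSSYT T),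
    ∏ c : ↥(cellsD B lam mu), f ((T c : ℕ) + 1) c.val

/-- `M`-truncated Schur multiple zeta value for a general filling `s` of the diagram. -/
noncomputable def zetaTF (M B : ℕ) (lam mu : ℕ → ℕ) (s : ℕ × ℕ → ℂ) : ℂ :=
  tabSum M B lam mu fun k c => (k : ℂ) ^ (-(s c))

/-- `M`-truncated diagonally constant Schur multiple zeta value `ζ^M_{λ/μ}(a)`. -/
noncomputable def zetaT (M B : ℕ) (lam mu : ℕ → ℕ) (a : ℤ → ℂ) : ℂ :=
  zetaTF M B lam mu fun c => a ((c.2 : ℤ) - (c.1 : ℤ))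

open Classical in
/-- `ζ^M_{λ/μ}(a)` with the zero convention for non-skew shapes. -/
noncomputable def zetaZ (M B : ℕ) (lam mu : ℕ → ℤ) (a : ℤ → ℂ) : ℂ :=
  if IsSkewZ B lam mu then
    zetaT M B (fun i => (lam i).toNat) (fun i => (mu i).toNat) a else 0

open Classical in
/-- `ζ^M_{λ'/μ'}(a)` applied to conjugates, with the zero convention. -/
noncomputable def zetaZConj (M B : ℕ) (lam mu : ℕ → ℤ) (a : ℤ → ℂ) : ℂ :=
  if IsSkewZ B lam mu then
    zetaT M (lam 0).toNat (conjF (fun i => (lam i).toNat) B)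
      (conjF (fun i => (mu i).toNat) B) a
  else 0

open Classical in
/-- `M`-truncated multiple zeta-star value `ζ^{⋆,M}(s_0,…,s_{d-1})`. -/
noncomputable def zetaStarT (M d : ℕ) (s : ℕ → ℂ) : ℂ :=
  ∑ f ∈ Finset.univ.filter (fun f : Fin d → Fin M => ∀ i j : Fin d, i ≤ j → f i ≤ f j),
    ∏ i : Fin d, (((f i : ℕ) + 1 : ℕ) : ℂ) ^ (-(s i))

open Classical in
/-- `M`-truncated multiple zeta value `ζ^{M}(s_0,…,s_{d-1})`. -/
noncomputable def zetaMT (M d : ℕ) (s : ℕ → ℂ) : ℂ :=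
  ∑ f ∈ Finset.univ.filter (fun f : Fin d → Fin M => ∀ i j : Fin d, i < j → f i < f j),
    ∏ i : Fin d, (((f i : ℕ) + 1 : ℕ) : ℂ) ^ (-(s i))

/-- The Riemann zeta value `ζ(k) = Σ_{n ≥ 1} n^{-k}`. -/
noncomputable def zetaVal (k : ℕ) : ℂ := ∑' n : ℕ, ((n + 1 : ℕ) : ℂ) ^ (-(k : ℤ))

/-- `ζ^⋆(1,k) = Σ_{1 ≤ m ≤ n} m^{-1} n^{-k}`. -/
noncomputable def zetaStarOne (k : ℕ) : ℂ :=
  ∑' n : ℕ, (∑ m ∈ Finset.Icc 1 (n + 1), ((m : ℂ))⁻¹) * ((n + 1 : ℕ) : ℂ) ^ (-(k : ℤ))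


section PluckerAux

variable {R : Type*} [CommRing R] {ι : Type*} [Fintype ι] [DecidableEq ι]

/-- rows in their own slot -/
def pqOwn (A B : Matrix ι ι R) : ι ⊕ ι → ι ⊕ ι → R :=
  Sum.elim (fun i => Sum.elim (A i) 0) (fun i => Sum.elim 0 (B i))

/-- rows in the wrong slot -/
def pqSwap (A B : Matrix ι ι R) : ι ⊕ ι → ι ⊕ ι → R :=
  Sum.elim (fun i => Sum.elim 0 (A i)) (fun i => Sum.elim (B i) 0)

/-- the doubled determinant with the rows of `Q` and `P` exchanged -/
def pqE (A B : Matrix ι ι R) (P Q : Finset ι) : R :=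
  Matrix.detRowAlternating ((Q.disjSum P).piecewise (pqSwap A B) (pqOwn A B))

theorem pq_sum (A B : Matrix ι ι R) (T1 T2 : Finset ι) :
    ∑ P ∈ T1.powerset, ∑ Q ∈ T2.powerset, pqE A B P Q =
      Matrix.det (Matrix.of ((T2.disjSum T1).piecewise (pqSwap A B + pqOwn A B) (pqOwn A B))) := by
  have h := (Matrix.detRowAlternating (n := ι ⊕ ι) (R := R)).toMultilinearMap.map_piecewise_add
    (pqSwap A B) (pqOwn A B) (T2.disjSum T1)
  refine Eq.trans ?_ h.symm
  rw [← Finset.sum_product']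
  refine Finset.sum_bij' (fun x _ => x.2.disjSum x.1) (fun s _ => (s.toRight, s.toLeft)) ?_ ?_ ?_ ?_ ?_
  · intro x hx
    simp only [Finset.mem_product, Finset.mem_powerset] at hx ⊢
    exact Finset.disjSum_mono hx.2 hx.1
  · intro s hs
    simp only [Finset.mem_product, Finset.mem_powerset] at hs ⊢
    constructor
    · intro x hx
      have := hs (Finset.mem_toRight.1 hx)
      simpa using this
    · intro x hx
      have := hs (Finset.mem_toLeft.1 hx)
      simpa using this
  · intro x hx
    simp
  · intro s hs
    ext x
    rcases x with x | x <;> simp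
  · intro x hx
    rfl

theorem pq_det (A B : Matrix ι ι R) (T1 T2 : Finset ι) (hd : Disjoint T1 T2)
    (hAB : ∀ i, i ∉ T1 → i ∉ T2 → A i = B i) :
    Matrix.det (Matrix.of ((T2.disjSum T1).piecewise (pqSwap A B + pqOwn A B) (pqOwn A B))) =
      Matrix.det (Matrix.of (T1.piecewise B A)) * Matrix.det (Matrix.of (T1.piecewise A B)) := by
  let Z : Matrix (ι ⊕ ι) (ι ⊕ ι) R :=
    Matrix.of ((T2.disjSum T1).piecewise (pqSwap A B + pqOwn A B) (pqOwn A B))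
  let dC : ι → R := fun i => if i ∈ T1 ∨ i ∈ T2 then 0 else 1
  let d2 : ι → R := fun i => if i ∈ T2 then 1 else 0
  have hZ : Z = Matrix.fromBlocks A (Matrix.of fun i j => if i ∈ T2 then A i j else 0)
      (Matrix.of fun i j => if i ∈ T1 then B i j else 0) B := by
    ext i j
    rcases i with i | i <;> rcases j with j | j <;>
      simp [Z, Finset.piecewise, pqSwap, pqOwn] <;> split_ifs <;> simp
  have key : Matrix.fromBlocks 1 0 (Matrix.diagonal d2) 1 *
      (Matrix.fromBlocks 1 (-Matrix.diagonal d2) 0 1 *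
      (Matrix.fromBlocks 1 0 (Matrix.diagonal dC) 1 *
      (Z * Matrix.fromBlocks 1 0 (-1) 1))) =
      Matrix.fromBlocks (Matrix.of (T1.piecewise A B))
        (Matrix.of fun i j => if i ∈ T2 then A i j - B i j else 0) 0
        (Matrix.of (T1.piecewise B A)) := by
    rw [hZ]
    simp only [Matrix.fromBlocks_multiply]
    have hd' : ∀ i, i ∈ T1 → i ∉ T2 := fun i h1 h2 => Finset.disjoint_left.1 hd h1 h2
    ext i j
    rcases i with i | i <;> rcases j with j | j <;>
      by_cases h1 : i ∈ T1 <;> by_cases h2 : i ∈ T2 <;>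
      simp_all [Finset.piecewise, d2, dC, Matrix.diagonal_mul, sub_eq_add_neg]
  have hdet := congrArg Matrix.det key
  simp only [Matrix.det_mul, Matrix.det_fromBlocks_zero₁₂, Matrix.det_fromBlocks_zero₂₁,
    Matrix.det_one, one_mul, mul_one] at hdet
  rw [mul_comm] at hdet
  exact hdet

theorem pq_zero (A B : Matrix ι ι R) (P Q : Finset ι) (h : P.card ≠ Q.card) :
    pqE A B P Q = 0 := by
  unfold pqE
  change Matrix.det (Matrix.of ((Q.disjSum P).piecewise (pqSwap A B) (pqOwn A B))) = 0
  rw [← Matrix.det_transpose, Matrix.det_apply]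
  refine Finset.sum_eq_zero fun σ _ => ?_
  by_contra hne
  have hne' : ∀ i, (Matrix.of ((Q.disjSum P).piecewise (pqSwap A B) (pqOwn A B))) i (σ i) ≠ 0 := by
    intro i hi
    apply hne
    have : (∏ i, (Matrix.of ((Q.disjSum P).piecewise (pqSwap A B) (pqOwn A B)))ᵀ (σ i) i) = 0 :=
      Finset.prod_eq_zero (Finset.mem_univ i) hi
    rw [this, smul_zero]
  have h1 : ∀ i, (σ i).isLeft = true ↔ i ∈ (Finset.univ \ Q).disjSum P := by
    intro i
    have hi := hne' i
    rcases i with i | i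
    · by_cases hQ : i ∈ Q <;> rcases hs : σ (Sum.inl i) with k | k <;>
        simp_all [Finset.piecewise, pqSwap, pqOwn]
    · by_cases hQ : i ∈ P <;> rcases hs : σ (Sum.inr i) with k | k <;>
        simp_all [Finset.piecewise, pqSwap, pqOwn]
  have h2 : ((Finset.univ \ Q).disjSum P).map σ.toEmbedding =
      (Finset.univ : Finset ι).map Function.Embedding.inl := by
    ext x
    simp only [Finset.mem_map, Finset.mem_univ, true_and]
    constructor
    · rintro ⟨i, hi, rfl⟩
      have := (h1 i).2 hi
      obtain ⟨y, hy⟩ := Sum.isLeft_iff.1 this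
      exact ⟨y, hy.symm⟩
    · rintro ⟨y, rfl⟩
      refine ⟨σ.symm (Sum.inl y), (h1 _).1 (by simp), by simp⟩
  have h3 := congrArg Finset.card h2
  simp only [Finset.card_map, Finset.card_disjSum] at h3
  have h4 := Finset.card_sdiff_add_card_eq_card (Finset.subset_univ Q)
  omega

theorem pq_perm (t : ℕ) (a b : ℕ → ι) (ha : Set.InjOn a (Set.Iio t)) (hb : Set.InjOn b (Set.Iio t)) :
    ∃ σ : Equiv.Perm (ι ⊕ ι), Equiv.Perm.sign σ = (-1) ^ t ∧
      (∀ i < t, σ (Sum.inl (b i)) = Sum.inr (a i)) ∧ (∀ i < t, σ (Sum.inr (a i)) = Sum.inl (b i)) ∧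
      (∀ k, (∀ i < t, k ≠ b i) → σ (Sum.inl k) = Sum.inl k) ∧
      (∀ k, (∀ i < t, k ≠ a i) → σ (Sum.inr k) = Sum.inr k) := by
  induction t with
  | zero => exact ⟨1, by simp⟩
  | succ t ih =>
    obtain ⟨σ, h0, h1, h2, h3, h4⟩ := ih
      (ha.mono (fun x hx => by simp at hx ⊢; omega)) (hb.mono (fun x hx => by simp at hx ⊢; omega))
    have hbne : ∀ i < t, b i ≠ b t := fun i hi h => by
      have := hb (by simp; omega) (by simp) h
      omega
    have hane : ∀ i < t, a i ≠ a t := fun i hi h => by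
      have := ha (by simp; omega) (by simp) h
      omega
    refine ⟨σ * Equiv.swap (Sum.inl (b t)) (Sum.inr (a t)), ?_, ?_, ?_, ?_, ?_⟩
    · rw [Equiv.Perm.sign_mul, h0, Equiv.Perm.sign_swap (by simp), pow_succ]
    · intro i hi
      rcases Nat.lt_succ_iff_lt_or_eq.1 hi with hi | rfl
      · rw [Equiv.Perm.mul_apply, Equiv.swap_apply_of_ne_of_ne (by simpa using hbne i hi) (by simp),
          h1 i hi]
      · rw [Equiv.Perm.mul_apply, Equiv.swap_apply_left, h4]
        exact fun j hj h => hane j hj h.symm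
    · intro i hi
      rcases Nat.lt_succ_iff_lt_or_eq.1 hi with hi | rfl
      · rw [Equiv.Perm.mul_apply, Equiv.swap_apply_of_ne_of_ne (by simp) (by simpa using hane i hi),
          h2 i hi]
      · rw [Equiv.Perm.mul_apply, Equiv.swap_apply_right, h3]
        exact fun j hj h => hbne j hj h.symm
    · intro k hk
      rw [Equiv.Perm.mul_apply, Equiv.swap_apply_of_ne_of_ne (by simpa using hk t (by omega)) (by simp)]
      exact h3 k fun i hi => hk i (by omega)
    · intro k hk
      rw [Equiv.Perm.mul_apply, Equiv.swap_apply_of_ne_of_ne (by simp) (by simpa using hk t (by omega))]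
      exact h4 k fun i hi => hk i (by omega)

theorem pq_term (A B c1 c2 : Matrix ι ι R) (t : ℕ) (a b : ℕ → ι)
    (ha : Set.InjOn a (Set.Iio t)) (hb : Set.InjOn b (Set.Iio t))
    (P Q : Finset ι) (hP : P = (Finset.range t).image a) (hQ : Q = (Finset.range t).image b)
    (h1 : ∀ i < t, c1 (b i) = B (a i)) (h1' : ∀ k, k ∉ Q → c1 k = A k)
    (h2 : ∀ i < t, c2 (a i) = A (b i)) (h2' : ∀ k, k ∉ P → c2 k = B k) :
    pqE A B P Q = (-1) ^ t * (c1.det * c2.det) := by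
  obtain ⟨σ, s0, s1, s2, s3, s4⟩ := pq_perm t a b ha hb
  have hm : (Matrix.of ((Q.disjSum P).piecewise (pqSwap A B) (pqOwn A B))).submatrix σ id =
      Matrix.fromBlocks c1 0 0 c2 := by
    ext i j
    rcases i with i | i
    · by_cases hi : i ∈ Q
      · have hi0 := hi
        rw [hQ] at hi
        obtain ⟨k, hk, rfl⟩ := Finset.mem_image.1 hi
        have hk := Finset.mem_range.1 hk
        have hp : a k ∈ P := by rw [hP]; exact Finset.mem_image_of_mem _ (by simpa using hk)
        rcases j with j | j <;>
          simp [s1 k hk, h1 k hk, Finset.piecewise, pqSwap, hp]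
      · have : σ (Sum.inl i) = Sum.inl i := s3 i fun k hk h => hi (by
          rw [hQ, h]; exact Finset.mem_image_of_mem _ (by simpa using hk))
        rcases j with j | j <;>
          simp [this, h1' i hi, Finset.piecewise, pqOwn, hi]
    · by_cases hi : i ∈ P
      · have hi0 := hi
        rw [hP] at hi
        obtain ⟨k, hk, rfl⟩ := Finset.mem_image.1 hi
        have hk := Finset.mem_range.1 hk
        have hp : b k ∈ Q := by rw [hQ]; exact Finset.mem_image_of_mem _ (by simpa using hk)
        rcases j with j | j <;>
          simp [s2 k hk, h2 k hk, Finset.piecewise, pqSwap, hp]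
      · have : σ (Sum.inr i) = Sum.inr i := s4 i fun k hk h => hi (by
          rw [hP, h]; exact Finset.mem_image_of_mem _ (by simpa using hk))
        rcases j with j | j <;>
          simp [this, h2' i hi, Finset.piecewise, pqOwn, hi]
  have hdet := congrArg Matrix.det hm
  rw [Matrix.det_permute, s0, Matrix.det_fromBlocks_zero₁₂] at hdet
  rw [← hdet]
  change pqE A B P Q = (-1) ^ t * (_ * pqE A B P Q)
  rw [← mul_assoc]
  have : ((-1 : R) ^ t * (((-1 : ℤˣ) ^ t : ℤˣ) : ℤ)) = 1 := by
    push_cast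
    rw [← mul_pow]; simp
  rw [this, one_mul]

end PluckerAux

section PluckerPos

variable {R : Type*} [CommRing R]

/-- column vectors: index `0` is the extra basis vector, `c + 1` is the column `c` of `U` -/
def pqW {N : ℕ} (U : Matrix (Fin N) (Fin N) R) (r' : ℕ) (i : Fin (r' + 1)) (c : ℕ) : R :=
  if c = 0 then (if i = 0 then (-1) ^ r' else 0) else matExt U (r' - i) (c - 1)

/-- the determinant attached to a position function -/
def pqD {N : ℕ} (U : Matrix (Fin N) (Fin N) R) (r' : ℕ) (f : ℕ → ℕ) : R :=
  Matrix.det (Matrix.of fun k i : Fin (r' + 1) => pqW U r' i (f k))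

def posA (r' : ℕ) (κ : ℕ → ℕ) (k : ℕ) : ℕ := κ k + (r' - k) + 1

def posB (r' : ℕ) (κ : ℕ → ℕ) (k : ℕ) : ℕ := κ k + (r' - k)

theorem pqW_pos {N : ℕ} (U : Matrix (Fin N) (Fin N) R) (r' : ℕ) (i : Fin (r' + 1)) (c : ℕ)
    (h : c ≠ 0) : pqW U r' i c = matExt U (r' - i) (c - 1) := by
  rw [pqW, if_neg h]

theorem schur_posA {N : ℕ} (U : Matrix (Fin N) (Fin N) R) (r' : ℕ) (κ : ℕ → ℕ) :
    SchurV U (r' + 1) κ (fun _ => 0) = pqD U r' (posA r' κ) := by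
  unfold SchurV pqD
  rw [← Matrix.det_transpose, ← Matrix.det_submatrix_equiv_self Fin.revPerm]
  congr 1
  ext k i
  simp only [Matrix.submatrix_apply, Matrix.transpose_apply, Matrix.of_apply, maya,
    Fin.revPerm_apply, Fin.val_rev]
  have hk := k.2
  have hi := i.2
  rw [pqW_pos _ _ _ _ (by rw [posA]; omega), posA]
  congr 1
  · omega
  · have : r' + 1 - 1 - (r' + 1 - (↑k + 1)) = (k : ℕ) := by omega
    rw [this]; omega

theorem schur_posB {N : ℕ} (U : Matrix (Fin N) (Fin N) R) (r' : ℕ) (κ : ℕ → ℕ) (h : κ r' = 0) :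
    SchurV U r' κ (fun _ => 0) = pqD U r' (posB r' κ) := by
  unfold SchurV pqD
  rw [Matrix.det_succ_row _ (Fin.last r'), Finset.sum_eq_single 0]
  · have h0 : (Matrix.of fun k i : Fin (r' + 1) => pqW U r' i (posB r' κ k)) (Fin.last r') 0
        = (-1) ^ r' := by
      simp [pqW, posB, h]
    rw [h0]
    have h1 : ((-1 : R) ^ ((Fin.last r' : Fin (r' + 1)) + (0 : Fin (r' + 1)) : ℕ)) * (-1) ^ r' = 1 := by
      simp [← mul_pow]
    rw [h1, one_mul, ← Matrix.det_transpose, ← Matrix.det_submatrix_equiv_self Fin.revPerm]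
    congr 1
    ext k i
    simp only [Matrix.submatrix_apply, Matrix.transpose_apply, Matrix.of_apply, maya,
      Fin.revPerm_apply, Fin.val_rev, Fin.succAbove_last, Fin.val_castSucc, Fin.succAbove_zero]
    have hk := k.2
    have hi := i.2
    rw [pqW_pos _ _ _ _ (by rw [posB]; omega), posB, Fin.val_succ]
    congr 1
    · omega
    · have : r' - 1 - (r' - (↑k + 1)) = (k : ℕ) := by omega
      rw [this]; omega
  · intro b _ hb
    have : (Matrix.of fun k i : Fin (r' + 1) => pqW U r' i (posB r' κ k)) (Fin.last r') b = 0 := by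
      simp [pqW, posB, h, hb]
    rw [this]; simp
  · simp

theorem pqD_perm {N : ℕ} (U : Matrix (Fin N) (Fin N) R) (r' : ℕ) (f g : ℕ → ℕ)
    (σ : Equiv.Perm (Fin (r' + 1))) (h : ∀ k : Fin (r' + 1), f k = g (σ k)) :
    pqD U r' f = (Equiv.Perm.sign σ : ℤ) * pqD U r' g := by
  unfold pqD
  rw [← Matrix.det_permute]
  congr 1
  ext k i
  simp [h]

theorem cyc_up (r' a b : ℕ) (hab : a ≤ b) (hb : b ≤ r') :
    ∃ σ : Equiv.Perm (Fin (r' + 1)), Equiv.Perm.sign σ = (-1) ^ (b - a) ∧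
      ∀ k : Fin (r' + 1), (σ k : ℕ) =
        if (k : ℕ) = b then a else if a ≤ (k : ℕ) ∧ (k : ℕ) < b then (k : ℕ) + 1 else k := by
  have hle : (⟨a, by omega⟩ : Fin (r' + 1)) ≤ ⟨b, by omega⟩ := hab
  refine ⟨Fin.cycleIcc ⟨a, by omega⟩ ⟨b, by omega⟩, ?_, ?_⟩
  · rw [Fin.sign_cycleIcc_of_le hle]
  · intro k
    split_ifs with h1 h2
    · have : k = ⟨b, by omega⟩ := Fin.ext h1
      rw [this, Fin.cycleIcc_of_last hle]
    · rw [Fin.cycleIcc_of_ge_of_lt (Fin.le_def.2 h2.1) (Fin.lt_def.2 h2.2), Fin.val_add_one_of_lt]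
      rw [Fin.lt_def]
      simp
      omega
    · by_cases h3 : (k : ℕ) < a
      · rw [Fin.cycleIcc_of_lt (Fin.lt_def.2 h3)]
      · rw [Fin.cycleIcc_of_gt (Fin.lt_def.2 (by simp; omega))]

theorem cyc_down (r' a b : ℕ) (hab : a ≤ b) (hb : b ≤ r') :
    ∃ σ : Equiv.Perm (Fin (r' + 1)), Equiv.Perm.sign σ = (-1) ^ (b - a) ∧
      ∀ k : Fin (r' + 1), (σ k : ℕ) =
        if (k : ℕ) = a then b else if a < (k : ℕ) ∧ (k : ℕ) ≤ b then (k : ℕ) - 1 else k := by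
  obtain ⟨σ, h0, h1⟩ := cyc_up r' a b hab hb
  refine ⟨σ⁻¹, by rw [Equiv.Perm.sign_inv, h0], ?_⟩
  intro k
  have h2 := h1 (σ⁻¹ k)
  rw [show σ (σ⁻¹ k) = k from σ.apply_symm_apply k] at h2
  split_ifs at h2 ⊢ <;> omega

theorem iterOp_succ (op : ℕ → ℕ → (ℕ → ℕ) → ℕ → ℕ) (t : ℕ) (a b k : ℕ → ℕ) :
    iterOp op (t + 1) a b k =
      op (a 0) (b 0) (iterOp op t (fun i => a (i + 1)) (fun i => b (i + 1)) k) := by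
  unfold iterOp
  rw [List.range_succ_eq_map, List.foldr_cons, List.foldr_map]

theorem add_iter (r' : ℕ) (lam : ℕ → ℕ) (t : ℕ) : ∀ (a b : ℕ → ℕ),
    (∀ i < t, 1 ≤ a i ∧ a i ≤ b i ∧ b i ≤ r') →
    (∀ i j, i < j → j < t → a i < a j ∧ b j < b i) →
    ∃ (σ : Equiv.Perm (Fin (r' + 1))) (g : ℕ → ℕ),
      Equiv.Perm.sign σ = (-1) ^ (∑ i ∈ Finset.range t, (b i - a i)) ∧
      (∀ k : Fin (r' + 1), posA r' (iterOp AddOp t a b lam) k = g (σ k)) ∧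
      (∀ i < t, g (b i) = posB r' lam (a i - 1)) ∧
      (∀ k, (∀ i < t, k ≠ b i) → g k = posA r' lam k) ∧
      (∀ k : Fin (r' + 1), (∀ i < t, (k : ℕ) < a i ∨ b i < (k : ℕ)) → σ k = k) := by
  induction t with
  | zero => intro a b _ _; exact ⟨1, posA r' lam, by simp [iterOp]⟩
  | succ t ih =>
    intro a b h1 h2
    obtain ⟨σ, g, s0, s1, s2, s3, s4⟩ := ih (fun i => a (i + 1)) (fun i => b (i + 1))
      (fun i hi => h1 (i + 1) (by omega)) (fun i j hij hj => h2 (i + 1) (j + 1) (by omega) (by omega))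
    rw [iterOp_succ]
    generalize iterOp AddOp t (fun i => a (i + 1)) (fun i => b (i + 1)) lam = κ at *
    obtain ⟨h01, h02, h03⟩ := h1 0 (by omega)
    obtain ⟨c, c0, c1⟩ := cyc_down r' (a 0) (b 0) h02 h03
    have hb0 : σ ⟨b 0, by omega⟩ = ⟨b 0, by omega⟩ :=
      s4 _ fun i hi => Or.inr (h2 0 (i + 1) (by omega) (by omega)).2
    have ha0 : posB r' κ (a 0 - 1) = posB r' lam (a 0 - 1) := by
      have e1 := s1 ⟨a 0 - 1, by omega⟩
      rw [s4 _ fun i hi => Or.inl ?_, s3] at e1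
      · simp only [posA, posB] at e1 ⊢
        omega
      · intro i hi
        have := (h2 0 (i + 1) (by omega) (by omega)).1
        have := (h1 (i + 1) (by omega)).2.1
        simp only
        omega
      · have := (h2 0 (i + 1) (by omega) (by omega)).1
        simp only
        omega
    refine ⟨σ * c, Function.update g (b 0) (posB r' lam (a 0 - 1)), ?_, ?_, ?_, ?_, ?_⟩
    · rw [Equiv.Perm.sign_mul, s0, c0, Finset.sum_range_succ', pow_add]
    · intro k
      rw [Equiv.Perm.mul_apply]
      have hc := c1 k
      by_cases hk : (k : ℕ) = a 0
      · rw [if_pos hk] at hc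
        have : c k = ⟨b 0, by omega⟩ := Fin.ext hc
        rw [this, hb0, ← ha0]
        simp only [posA, posB, AddOp, Function.update_self, hk]
        rw [if_neg (by omega), if_pos trivial]
        omega
      · rw [if_neg hk] at hc
        have hne : ((σ (c k) : Fin (r' + 1)) : ℕ) ≠ b 0 := by
          intro he
          have h3 : σ (c k) = σ ⟨b 0, by omega⟩ := by rw [hb0]; exact Fin.ext he
          have h4 := σ.injective h3
          rw [h4] at hc
          simp only at hc
          split_ifs at hc <;> omega
        rw [Function.update_of_ne hne, ← s1, hc]
        have hk2 := k.2
        simp only [posA, AddOp]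
        split_ifs <;> omega
    · intro i hi
      rcases i with _ | i
      · simp
      · rw [Function.update_of_ne, s2 i (by omega)]
        have := (h2 0 (i + 1) (by omega) hi).2
        omega
    · intro k hk
      rw [Function.update_of_ne (hk 0 (by omega))]
      exact s3 k fun i hi => hk (i + 1) (by omega)
    · intro k hk
      have hc := c1 k
      have hk0 := hk 0 (by omega)
      rw [if_neg (by omega), if_neg (by omega)] at hc
      rw [Equiv.Perm.mul_apply, Fin.ext hc]
      exact s4 k fun i hi => hk (i + 1) (by omega)

theorem rem_iter (r' : ℕ) (lam : ℕ → ℕ) (hlam : ∀ i j, i ≤ j → lam j ≤ lam i) (t : ℕ) :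
    ∀ (a b : ℕ → ℕ),
    (∀ i < t, 1 ≤ a i ∧ a i ≤ b i ∧ b i ≤ r' ∧ lam (b i) < lam (b i - 1)) →
    (∀ i j, i < j → j < t → a i < a j ∧ b j < b i) →
    ∃ (σ : Equiv.Perm (Fin (r' + 1))) (g : ℕ → ℕ),
      Equiv.Perm.sign σ = (-1) ^ (∑ i ∈ Finset.range t, (b i - a i)) ∧
      (∀ k : Fin (r' + 1), posB r' (iterOp RemOp t a b lam) k = g (σ k)) ∧
      (∀ i < t, g (a i - 1) = posA r' lam (b i)) ∧
      (∀ k, (∀ i < t, k ≠ a i - 1) → g k = posB r' lam k) ∧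
      (∀ k : Fin (r' + 1), (∀ i < t, (k : ℕ) + 1 < a i ∨ b i ≤ (k : ℕ)) → σ k = k) ∧
      (∀ β, (∀ i < t, b i < β) → ∀ k < β, lam (β - 1) ≤ iterOp RemOp t a b lam k) ∧
      (∀ k, (∀ i < t, b i ≤ k) → iterOp RemOp t a b lam k = lam k) := by
  induction t with
  | zero =>
    intro a b _ _
    refine ⟨1, posB r' lam, by simp, by simp [iterOp], by simp, by simp, by simp, ?_, by simp [iterOp]⟩
    intro β _ k hk
    exact hlam _ _ (by omega)
  | succ t ih =>
    intro a b h1 h2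
    obtain ⟨σ, g, s0, s1, s2, s3, s4, s5, s6⟩ := ih (fun i => a (i + 1)) (fun i => b (i + 1))
      (fun i hi => h1 (i + 1) (by omega)) (fun i j hij hj => h2 (i + 1) (j + 1) (by omega) (by omega))
    rw [iterOp_succ]
    generalize iterOp RemOp t (fun i => a (i + 1)) (fun i => b (i + 1)) lam = κ at *
    obtain ⟨h01, h02, h03, h04⟩ := h1 0 (by omega)
    obtain ⟨c, c0, c1⟩ := cyc_up r' (a 0 - 1) (b 0 - 1) (by omega) (by omega)
    have ha0 : σ ⟨a 0 - 1, by omega⟩ = ⟨a 0 - 1, by omega⟩ :=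
      s4 _ fun i hi => Or.inl (by
        have := (h2 0 (i + 1) (by omega) (by omega)).1
        simp only
        omega)
    have hb0 : κ (b 0) = lam (b 0) := s6 _ fun i hi => (h2 0 (i + 1) (by omega) (by omega)).2.le
    have hκ : ∀ k < b 0, lam (b 0) < κ k := fun k hk =>
      lt_of_lt_of_le h04 (s5 (b 0) (fun i hi => (h2 0 (i + 1) (by omega) (by omega)).2) k hk)
    have hκ' : ∀ k, b 0 ≤ k → κ k = lam k := fun k hk =>
      s6 k fun i hi => ((h2 0 (i + 1) (by omega) (by omega)).2.le.trans hk)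
    refine ⟨σ * c, Function.update g (a 0 - 1) (posA r' lam (b 0)), ?_, ?_, ?_, ?_, ?_, ?_, ?_⟩
    · rw [Equiv.Perm.sign_mul, s0, c0, Finset.sum_range_succ', pow_add]
      congr 2
      omega
    · intro k
      rw [Equiv.Perm.mul_apply]
      have hc := c1 k
      by_cases hk : (k : ℕ) = b 0 - 1
      · rw [if_pos hk] at hc
        have : c k = ⟨a 0 - 1, by omega⟩ := Fin.ext hc
        rw [this, ha0]
        simp only [posA, posB, RemOp, Function.update_self, hk]
        rw [if_neg (by omega), if_neg (by omega), if_pos (by omega), hb0]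
        omega
      · rw [if_neg hk] at hc
        have hne : ((σ (c k) : Fin (r' + 1)) : ℕ) ≠ a 0 - 1 := by
          intro he
          have h3 : σ (c k) = σ ⟨a 0 - 1, by omega⟩ := by rw [ha0]; exact Fin.ext he
          have h4 := σ.injective h3
          rw [h4] at hc
          simp only at hc
          split_ifs at hc <;> omega
        rw [Function.update_of_ne hne, ← s1, hc]
        have hk2 := k.2
        have hk3 := hκ (k + 1)
        simp only [posB, RemOp]
        split_ifs <;> omega
    · intro i hi
      rcases i with _ | i
      · simp
      · rw [Function.update_of_ne, s2 i (by omega)]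
        have := (h2 0 (i + 1) (by omega) hi).1
        omega
    · intro k hk
      rw [Function.update_of_ne (hk 0 (by omega))]
      exact s3 k fun i hi => hk (i + 1) (by omega)
    · intro k hk
      have hc := c1 k
      have hk0 := hk 0 (by omega)
      rw [if_neg (by omega), if_neg (by omega)] at hc
      rw [Equiv.Perm.mul_apply, Fin.ext hc]
      exact s4 k fun i hi => hk (i + 1) (by omega)
    · intro β hβ k hk
      have hβ0 := hβ 0 (by omega)
      have e1 := hlam (b 0) (β - 1) (by omega)
      have e2 := hκ k
      have e3 := hκ (k + 1)
      have e4 := hlam k (β - 1) (by omega)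
      have e5 := hκ' k
      simp only [RemOp]
      split_ifs <;> omega
    · intro k hk
      have hk0 := hk 0 (by omega)
      have e5 := hκ' k hk0
      simp only [RemOp]
      split_ifs <;> omega

/-- block rotation -/
theorem rot_exists (r' : ℕ) (s : ℕ → ℕ) (u v : ℕ) (huv : u ≤ v)
    (hs : ∀ j, u ≤ j → j < v → s j < s (j + 1)) (hv : s v ≤ r' + 1) :
    ∃ ρ : Equiv.Perm (Fin (r' + 1)),
      (∀ k : Fin (r' + 1), ∀ j, u ≤ j → j < v → (k : ℕ) = s j → (ρ k : ℕ) = s (j + 1) - 1) ∧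
      (∀ k : Fin (r' + 1), s u ≤ (k : ℕ) → (k : ℕ) < s v → (∀ j, u ≤ j → j < v → (k : ℕ) ≠ s j) →
        (ρ k : ℕ) = k - 1) ∧
      (∀ k : Fin (r' + 1), ((k : ℕ) < s u ∨ s v ≤ (k : ℕ)) → ρ k = k) := by
  induction v, huv using Nat.le_induction with
  | base =>
    refine ⟨1, ?_, ?_, ?_⟩
    · intro k j h1 h2; omega
    · intro k h1 h2; omega
    · intro k _; rfl
  | succ v huv ih =>
    have hv1 := hs v huv (by omega)
    obtain ⟨ρ, p1, p2, p3⟩ := ih (fun j h1 h2 => hs j h1 (by omega)) (by omega)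
    obtain ⟨c, -, c1⟩ := cyc_down r' (s v) (s (v + 1) - 1) (by omega) (by omega)
    have huv' : s u ≤ s v := by
      have : ∀ w, u ≤ w → w ≤ v → s u ≤ s w := by
        intro w hw
        induction w, hw using Nat.le_induction with
        | base => intro _; exact le_rfl
        | succ w hw ih2 =>
          intro h
          exact (ih2 (by omega)).trans (hs w hw (by omega)).le
      exact this v huv le_rfl
    have hmono : ∀ w, u ≤ w → w < v → s w < s v := by
      intro w hw
      have : ∀ x, w + 1 ≤ x → x ≤ v → s w < s x := by
        intro x hx
        induction x, hx using Nat.le_induction with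
        | base => intro h; exact hs w hw (by omega)
        | succ x hx ih2 =>
          intro h
          exact (ih2 (by omega)).trans (hs x (by omega) (by omega))
      intro h
      exact this v h le_rfl
    refine ⟨ρ * c, ?_, ?_, ?_⟩
    · intro k j h1 h2 hk
      rw [Equiv.Perm.mul_apply]
      have hc := c1 k
      rcases Nat.lt_succ_iff_lt_or_eq.1 h2 with h3 | rfl
      · have := hmono j h1 h3
        rw [if_neg (by omega), if_neg (by omega)] at hc
        rw [Fin.ext hc]
        exact p1 k j h1 h3 hk
      · rw [if_pos hk] at hc
        rw [p3 (c k) (Or.inr (by omega)), hc]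
    · intro k h1 h2 h3
      rw [Equiv.Perm.mul_apply]
      have hc := c1 k
      have := h3 v huv (by omega)
      rw [if_neg this] at hc
      by_cases h4 : (k : ℕ) < s v
      · rw [if_neg (by omega)] at hc
        rw [Fin.ext hc]
        exact p2 k h1 h4 fun j h5 h6 => h3 j h5 (by omega)
      · rw [if_pos (by omega)] at hc
        rw [p3 (c k) (Or.inr (by omega)), hc]
    · intro k hk
      rw [Equiv.Perm.mul_apply]
      have hc := c1 k
      rw [if_neg (by omega), if_neg (by omega)] at hc
      rw [Fin.ext hc]
      exact p3 k (by omega)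

end PluckerPos

section PluckerMain

theorem ascNth_mem (S : Finset ℕ) (i : ℕ) (h : i < S.card) : ascNth S i ∈ S := by
  unfold ascNth
  have h' : i < (S.sort (· ≤ ·)).length := by simpa using h
  rw [List.getD_eq_getElem _ _ h']
  exact (Finset.mem_sort (· ≤ ·)).1 (List.getElem_mem h')

theorem ascNth_lt (S : Finset ℕ) (i j : ℕ) (hij : i < j) (h : j < S.card) :
    ascNth S i < ascNth S j := by
  unfold ascNth
  have h' : j < (S.sort (· ≤ ·)).length := by simpa using h
  rw [List.getD_eq_getElem _ _ h', List.getD_eq_getElem _ _ (hij.trans h')]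
  exact (Finset.sortedLT_sort S).getElem_lt_getElem_of_lt hij

theorem ascNth_surj (S : Finset ℕ) (x : ℕ) (h : x ∈ S) : ∃ i < S.card, ascNth S i = x := by
  have hx : x ∈ S.sort (· ≤ ·) := (Finset.mem_sort (· ≤ ·)).2 h
  obtain ⟨i, hi, rfl⟩ := List.getElem_of_mem hx
  refine ⟨i, by simpa using hi, ?_⟩
  unfold ascNth
  rw [List.getD_eq_getElem _ _ hi]

theorem sum_powerset_im {R : Type*} [CommRing R] {ι : Type*} [DecidableEq ι] (f : ℕ → ι)
    (S : Finset ℕ) (hf : Set.InjOn f S) (G : Finset ι → R) :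
    ∑ u ∈ (S.image f).powerset, G u = ∑ P ∈ S.powerset, G (P.image f) := by
  rw [Finset.powerset_image, Finset.sum_image]
  intro P hP Q hQ h
  simp only [Finset.coe_powerset, Set.mem_preimage, Set.mem_powerset_iff, Finset.coe_subset] at hP hQ
  ext x
  have key : ∀ P Q : Finset ℕ, P ⊆ S → Q ⊆ S → P.image f = Q.image f → x ∈ P → x ∈ Q := by
    intro P Q hP hQ h hx
    have : f x ∈ Q.image f := h ▸ Finset.mem_image_of_mem f hx
    obtain ⟨y, hy, hxy⟩ := Finset.mem_image.1 this
    have := hf (hQ hy) (hP hx) hxy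
    exact this ▸ hy
  exact ⟨key P Q hP hQ h, key Q P hQ hP h.symm⟩

theorem pw_mem {ι R : Type*} [DecidableEq ι] (T : Finset ι) (A B : Matrix ι ι R) (k : ι)
    (h : k ∈ T) : T.piecewise A B k = A k := Finset.piecewise_eq_of_mem T _ _ h

theorem pw_notMem {ι R : Type*} [DecidableEq ι] (T : Finset ι) (A B : Matrix ι ι R) (k : ι)
    (h : k ∉ T) : T.piecewise A B k = B k := Finset.piecewise_eq_of_notMem T _ _ h

theorem main_s {R : Type*} [CommRing R] {N : ℕ} (U : Matrix (Fin N) (Fin N) R)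
    (r' n d : ℕ) (hd1 : 1 ≤ d) (hdn : d ≤ n) (lam s rr : ℕ → ℕ)
    (s0 : s 0 = 0) (hs : ∀ j ≤ n, s j < s (j + 1)) (hsn : s (n + 1) = r' + 1)
    (hrr : ∀ p, 1 ≤ p → p ≤ n → rr (p - 1) = s p)
    (hlam : ∀ i j, i ≤ j → lam j ≤ lam i)
    (hconst : ∀ k ≤ r', (∀ j ≤ n, k ≠ s j) → lam k = lam (k - 1))
    (hdrop : ∀ j, 1 ≤ j → j ≤ n → lam (s j) < lam (s j - 1)) (hz : lam r' = 0) :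
    SchurV U (r' + 1) lam (fun _ => 0) * SchurV U r' lam (fun _ => 0) =
      SchurV U (r' + 1) (fun i => if i < s d then lam i - 1 else lam i) (fun _ => 0) *
        SchurV U r' (fun i => if i < s d then lam i + 1 else lam i) (fun _ => 0) +
      ∑ t ∈ Finset.Icc 1 (min d (n - d + 1)),
        (-1 : R) ^ (t - 1) *
          ∑ P ∈ Finset.powersetCard t (Finset.Icc 1 d),
            ∑ Q ∈ Finset.powersetCard t (Finset.Icc d n),
              SchurV U (r' + 1)
                  (iterOp AddOp t (fun i => rr (ascNth P i - 1))
                    (fun i => rr (ascNth Q (t - 1 - i) - 1)) lam)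
                  (fun _ => 0) *
                SchurV U r'
                  (iterOp RemOp t (fun i => rr (ascNth P i - 1))
                    (fun i => rr (ascNth Q (t - 1 - i) - 1)) lam)
                  (fun _ => 0) := by
  -- monotonicity of `s`
  have hslt : ∀ i j, i < j → j ≤ n + 1 → s i < s j := by
    intro i j hij
    induction j, hij using Nat.le_induction with
    | base => intro h; exact hs i (by omega)
    | succ j hj ih => intro h; exact (ih (by omega)).trans (hs j (by omega))
  have hsle : ∀ i ≤ n, s i ≤ r' := fun i hi => by
    have := hslt i (n + 1) (by omega) le_rfl
    omega
  have hspos : ∀ i, 1 ≤ i → i ≤ n → 1 ≤ s i := fun i h1 h2 => by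
    have := hslt 0 i (by omega) (by omega)
    omega
  have hsinj : ∀ i j, i ≤ n → j ≤ n → s i = s j → i = j := by
    intro i j hi hj h
    rcases lt_trichotomy i j with h1 | h1 | h1
    · have := hslt i j h1 (by omega); omega
    · exact h1
    · have := hslt j i h1 (by omega); omega
  obtain ⟨ρ1, u1, u2, u3⟩ := rot_exists r' s 0 d (by omega) (fun j _ h => hs j (by omega))
    (by have := hsle d hdn; omega)
  obtain ⟨ρ2, v1, v2, v3⟩ := rot_exists r' s d (n + 1) (by omega) (fun j _ h => hs j (by omega))
    (by omega)
  have hρ1 : ∀ k : Fin (r' + 1), (k : ℕ) < s d → (ρ1 k : ℕ) < s d := by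
    intro k hk
    by_contra hcon
    have h1 := u3 (ρ1 k) (Or.inr (by omega))
    have h2 := ρ1.injective h1
    rw [h2] at hcon
    exact hcon hk
  have hρ2 : ∀ k : Fin (r' + 1), s d ≤ (k : ℕ) → s d ≤ (ρ2 k : ℕ) := by
    intro k hk
    by_contra hcon
    have h1 := v3 (ρ2 k) (Or.inl (by omega))
    have h2 := ρ2.injective h1
    rw [h2] at hcon
    exact hcon hk
  obtain ⟨ρ, hρ⟩ : ∃ ρ, ρ = ρ1 * ρ2 := ⟨_, rfl⟩
  have hρlo : ∀ k : Fin (r' + 1), (k : ℕ) < s d → ρ k = ρ1 k := by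
    intro k hk
    rw [hρ, Equiv.Perm.mul_apply, v3 k (Or.inl hk)]
  have hρhi : ∀ k : Fin (r' + 1), s d ≤ (k : ℕ) → ρ k = ρ2 k := by
    intro k hk
    rw [hρ, Equiv.Perm.mul_apply, u3 _ (Or.inr (hρ2 k hk))]
  have hρtop : ∀ k : Fin (r' + 1), ∀ j, j ≤ n → (k : ℕ) = s j → (ρ k : ℕ) = s (j + 1) - 1 := by
    intro k j hj hk
    by_cases hjd : j < d
    · rw [hρlo k (by rw [hk]; exact hslt j d hjd (by omega))]
      exact u1 k j (by omega) hjd hk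
    · rw [hρhi k (by
        rw [hk]
        rcases eq_or_lt_of_le (not_lt.1 hjd) with h | h
        · rw [h]
        · exact (hslt d j h (by omega)).le)]
      exact v1 k j (by omega) (by omega) hk
  have hρmid : ∀ k : Fin (r' + 1), (∀ j ≤ n, (k : ℕ) ≠ s j) → (ρ k : ℕ) = k - 1 := by
    intro k hk
    by_cases hkd : (k : ℕ) < s d
    · rw [hρlo k hkd]
      exact u2 k (by omega) hkd fun j _ h => hk j (by omega)
    · rw [hρhi k (by omega)]
      exact v2 k (by omega) (by have := k.2; omega) fun j _ h => hk j (by omega)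
  have hsign : Equiv.Perm.sign ρ = Equiv.Perm.sign ρ1 * Equiv.Perm.sign ρ2 := by
    rw [hρ, Equiv.Perm.sign_mul]
  -- the two matrices
  obtain ⟨A, hA⟩ : ∃ A : Matrix (Fin (r' + 1)) (Fin (r' + 1)) R,
      A = Matrix.of fun k i : Fin (r' + 1) => pqW U r' i (posA r' lam k) := ⟨_, rfl⟩
  obtain ⟨B, hB⟩ : ∃ B : Matrix (Fin (r' + 1)) (Fin (r' + 1)) R,
      B = Matrix.of fun k i : Fin (r' + 1) => pqW U r' i (posB r' lam (ρ k)) := ⟨_, rfl⟩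
  obtain ⟨F, hF⟩ : ∃ F : ℕ → Fin (r' + 1), ∀ x ≤ r', (F x : ℕ) = x :=
    ⟨fun x => Fin.ofNat (r' + 1) x, fun x hx => by simp; omega⟩
  have hagree : ∀ k : Fin (r' + 1), (∀ j ≤ n, (k : ℕ) ≠ s j) → A k = B k := by
    intro k hk
    have h1 := hρmid k hk
    have h2 := hconst k (by have := k.2; omega) hk
    have h3 := hk 0 (by omega)
    have h4 := k.2
    rw [hA, hB]
    ext i
    simp only [Matrix.of_apply]
    congr 1
    rw [posA, posB, h1, h2]
    omega
  let f1 : ℕ → Fin (r' + 1) := fun p => F (s (p - 1))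
  let f2 : ℕ → Fin (r' + 1) := fun q => F (s q)
  have hf1 : ∀ p, 1 ≤ p → p ≤ d → (f1 p : ℕ) = s (p - 1) := fun p _ h =>
    hF _ (hsle _ (by omega))
  have hf2 : ∀ q, q ≤ n → (f2 q : ℕ) = s q := fun q h => hF _ (hsle _ h)
  let T1 := (Finset.Icc 1 d).image f1
  let T2 := (Finset.Icc d n).image f2
  have hT1 : ∀ k : Fin (r' + 1), k ∈ T1 ↔ ∃ j < d, (k : ℕ) = s j := by
    intro k
    simp only [T1, Finset.mem_image, Finset.mem_Icc]
    constructor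
    · rintro ⟨p, hp, rfl⟩
      exact ⟨p - 1, by omega, hf1 p hp.1 hp.2⟩
    · rintro ⟨j, hj, hk⟩
      refine ⟨j + 1, by omega, Fin.ext ?_⟩
      rw [hf1 _ (by omega) (by omega), hk]
      rfl
  have hT2 : ∀ k : Fin (r' + 1), k ∈ T2 ↔ ∃ j, d ≤ j ∧ j ≤ n ∧ (k : ℕ) = s j := by
    intro k
    simp only [T2, Finset.mem_image, Finset.mem_Icc]
    constructor
    · rintro ⟨q, hq, rfl⟩
      exact ⟨q, hq.1, hq.2, hf2 q hq.2⟩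
    · rintro ⟨j, hj1, hj2, hk⟩
      exact ⟨j, ⟨hj1, hj2⟩, Fin.ext (by rw [hf2 _ hj2, hk])⟩
  have hdisj : Disjoint T1 T2 := by
    rw [Finset.disjoint_left]
    intro k h1 h2
    obtain ⟨j, hj, hk⟩ := (hT1 k).1 h1
    obtain ⟨j', hj1, hj2, hk'⟩ := (hT2 k).1 h2
    have := hsinj j j' (by omega) hj2 (by omega)
    omega
  have hagree' : ∀ k, k ∉ T1 → k ∉ T2 → A k = B k := by
    intro k h1 h2
    apply hagree
    intro j hj hk
    by_cases hjd : j < d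
    · exact h1 ((hT1 k).2 ⟨j, hjd, hk⟩)
    · exact h2 ((hT2 k).2 ⟨j, by omega, hj, hk⟩)
  have hmain := pq_sum A B T1 T2
  rw [pq_det A B T1 T2 hdisj hagree'] at hmain
  -- the right hand side
  have hlampos : ∀ k < s d, 1 ≤ lam k := by
    intro k hk
    have h1 := hdrop d hd1 hdn
    have h2 := hlam k (s d - 1) (by omega)
    omega
  have hR1 : Matrix.det (Matrix.of (T1.piecewise B A)) = (Equiv.Perm.sign ρ1 : ℤ) *
      SchurV U (r' + 1) (fun i => if i < s d then lam i - 1 else lam i) (fun _ => 0) := by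
    rw [schur_posA, pqD, ← Matrix.det_permute]
    congr 1
    ext k i
    simp only [Matrix.of_apply, Matrix.submatrix_apply, id]
    by_cases hk : (k : ℕ) < s d
    · have h1 : T1.piecewise B A k = B k := by
        by_cases hT : k ∈ T1
        · rw [pw_mem _ _ _ _ hT]
        · rw [pw_notMem _ _ _ _ hT]
          apply hagree' k hT
          intro h2
          obtain ⟨j, hj1, hj2, hj3⟩ := (hT2 k).1 h2
          rcases eq_or_lt_of_le hj1 with h | h
          · rw [← h] at hj3; omega
          · have := hslt d j h (by omega); omega
      rw [h1, hB]
      simp only [Matrix.of_apply]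
      rw [hρlo k hk]
      have h2 := hρ1 k hk
      have h3 := hlampos _ h2
      congr 1
      simp only [posA, posB, if_pos h2]
      omega
    · have hT : k ∉ T1 := by
        intro hT
        obtain ⟨j, hj, hk'⟩ := (hT1 k).1 hT
        have := hslt j d hj (by omega)
        omega
      rw [pw_notMem _ _ _ _ hT, hA, u3 k (Or.inr (by omega))]
      simp only [Matrix.of_apply, posA, if_neg hk]
  have hR2 : Matrix.det (Matrix.of (T1.piecewise A B)) = (Equiv.Perm.sign ρ2 : ℤ) *
      SchurV U r' (fun i => if i < s d then lam i + 1 else lam i) (fun _ => 0) := by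
    have hz2 : (fun i => if i < s d then lam i + 1 else lam i) r' = 0 := by
      have := hsle d hdn
      simp only
      rw [if_neg (by omega), hz]
    rw [schur_posB U r' (fun i => if i < s d then lam i + 1 else lam i) hz2, pqD, ← Matrix.det_permute]
    congr 1
    ext k i
    simp only [Matrix.of_apply, Matrix.submatrix_apply, id]
    by_cases hk : (k : ℕ) < s d
    · have h1 : T1.piecewise A B k = A k := by
        by_cases hT : k ∈ T1
        · rw [pw_mem _ _ _ _ hT]
        · rw [pw_notMem _ _ _ _ hT]
          symm
          apply hagree' k hT
          intro h2
          obtain ⟨j, hj1, hj2, hj3⟩ := (hT2 k).1 h2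
          rcases eq_or_lt_of_le hj1 with h | h
          · rw [← h] at hj3; omega
          · have := hslt d j h (by omega); omega
      rw [h1, hA, v3 k (Or.inl hk)]
      simp only [Matrix.of_apply]
      congr 1
      simp only [posA, posB, if_pos hk]
      omega
    · have hT : k ∉ T1 := by
        intro hT
        obtain ⟨j, hj, hk'⟩ := (hT1 k).1 hT
        have := hslt j d hj (by omega)
        omega
      have h2 := hρ2 k (by omega)
      rw [pw_notMem _ _ _ _ hT, hB]
      simp only [Matrix.of_apply]
      rw [hρhi k (by omega)]
      congr 1
      simp only [posB, if_neg (not_lt.2 h2)]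
  -- the terms of the sum
  have hterm : ∀ t, ∀ P ∈ Finset.powersetCard t (Finset.Icc 1 d),
      ∀ Q ∈ Finset.powersetCard t (Finset.Icc d n),
      pqE A B (P.image f1) (Q.image f2) = (Equiv.Perm.sign ρ : ℤ) * ((-1) ^ t *
        (SchurV U (r' + 1)
                  (iterOp AddOp t (fun i => rr (ascNth P i - 1))
                    (fun i => rr (ascNth Q (t - 1 - i) - 1)) lam)
                  (fun _ => 0) *
                SchurV U r'
                  (iterOp RemOp t (fun i => rr (ascNth P i - 1))
                    (fun i => rr (ascNth Q (t - 1 - i) - 1)) lam)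
                  (fun _ => 0))) := by
    intro t P hP Q hQ
    obtain ⟨hP1, hP2⟩ := Finset.mem_powersetCard.1 hP
    obtain ⟨hQ1, hQ2⟩ := Finset.mem_powersetCard.1 hQ
    have hp : ∀ i < t, 1 ≤ ascNth P i ∧ ascNth P i ≤ d := fun i hi =>
      Finset.mem_Icc.1 (hP1 (ascNth_mem P i (by omega)))
    have hq : ∀ i < t, d ≤ ascNth Q (t - 1 - i) ∧ ascNth Q (t - 1 - i) ≤ n := fun i hi =>
      Finset.mem_Icc.1 (hQ1 (ascNth_mem Q _ (by omega)))
    have hpm : ∀ i j, i < j → j < t → ascNth P i < ascNth P j := fun i j hij hj =>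
      ascNth_lt P i j hij (by omega)
    have hqm : ∀ i j, i < j → j < t → ascNth Q (t - 1 - j) < ascNth Q (t - 1 - i) :=
      fun i j hij hj => ascNth_lt Q _ _ (by omega) (by omega)
    have hra : ∀ i < t, rr (ascNth P i - 1) = s (ascNth P i) := fun i hi =>
      hrr _ (hp i hi).1 (by have := hp i hi; omega)
    have hrb : ∀ i < t, rr (ascNth Q (t - 1 - i) - 1) = s (ascNth Q (t - 1 - i)) := fun i hi =>
      hrr _ (by have := hq i hi; omega) (hq i hi).2
    have hc1 : ∀ i < t, 1 ≤ s (ascNth P i) ∧ s (ascNth P i) ≤ s (ascNth Q (t - 1 - i)) ∧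
        s (ascNth Q (t - 1 - i)) ≤ r' := by
      intro i hi
      have h1 := hp i hi
      have h2 := hq i hi
      refine ⟨hspos _ h1.1 (by omega), ?_, hsle _ h2.2⟩
      rcases eq_or_lt_of_le (h1.2.trans h2.1) with h | h
      · rw [h]
      · exact (hslt _ _ h (by omega)).le
    have hc2 : ∀ i j, i < j → j < t → rr (ascNth P i - 1) < rr (ascNth P j - 1) ∧
        rr (ascNth Q (t - 1 - j) - 1) < rr (ascNth Q (t - 1 - i) - 1) := by
      intro i j hij hj
      rw [hra i (by omega), hra j hj, hrb i (by omega), hrb j hj]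
      have := hp j hj
      have := hq i (by omega)
      exact ⟨hslt _ _ (hpm i j hij hj) (by omega), hslt _ _ (hqm i j hij hj) (by omega)⟩
    obtain ⟨σ1, g1, x0, x1, x2, x3, -⟩ := add_iter r' lam t (fun i => rr (ascNth P i - 1))
      (fun i => rr (ascNth Q (t - 1 - i) - 1))
      (fun i hi => by simp only [hra i hi, hrb i hi]; exact hc1 i hi) hc2
    obtain ⟨σ2, g2, y0, y1, y2, y3, -, -, y6⟩ := rem_iter r' lam hlam t
      (fun i => rr (ascNth P i - 1)) (fun i => rr (ascNth Q (t - 1 - i) - 1))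
      (fun i hi => by
        simp only [hra i hi, hrb i hi]
        have h1 := hc1 i hi
        have h2 := hq i hi
        exact ⟨h1.1, h1.2.1, h1.2.2, hdrop _ (by omega) h2.2⟩) hc2
    have hz' := y6 r' (fun i hi => by simp only [hrb i hi]; exact (hc1 i hi).2.2)
    rw [hz] at hz'
    rw [schur_posA, schur_posB _ _ _ hz', pqD_perm U r' _ g1 σ1 x1, pqD_perm U r' _ g2 σ2 y1]
    have ha : ∀ i < t, (f1 (ascNth P i) : ℕ) = s (ascNth P i - 1) := fun i hi =>
      hf1 _ (hp i hi).1 (hp i hi).2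
    have hb : ∀ i < t, (f2 (ascNth Q (t - 1 - i)) : ℕ) = s (ascNth Q (t - 1 - i)) := fun i hi =>
      hf2 _ (hq i hi).2
    have hρa : ∀ i < t, (ρ (f1 (ascNth P i)) : ℕ) = s (ascNth P i) - 1 := by
      intro i hi
      have h1 := hp i hi
      rw [hρtop _ (ascNth P i - 1) (by omega) (ha i hi)]
      congr 2
      omega
    have hainj : Set.InjOn (fun i => f1 (ascNth P i)) (Set.Iio t) := by
      intro i hi j hj hij
      simp only [Set.mem_Iio] at hi hj
      have h1 : s (ascNth P i - 1) = s (ascNth P j - 1) := by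
        rw [← ha i hi, ← ha j hj]
        exact congrArg Fin.val hij
      have h2 := hp i hi
      have h3 := hp j hj
      have h4 := hsinj _ _ (by omega) (by omega) h1
      rcases lt_trichotomy i j with h | h | h
      · have := hpm i j h hj; omega
      · exact h
      · have := hpm j i h hi; omega
    have hbinj : Set.InjOn (fun i => f2 (ascNth Q (t - 1 - i))) (Set.Iio t) := by
      intro i hi j hj hij
      simp only [Set.mem_Iio] at hi hj
      have h1 : s (ascNth Q (t - 1 - i)) = s (ascNth Q (t - 1 - j)) := by
        rw [← hb i hi, ← hb j hj]
        exact congrArg Fin.val hij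
      have h2 := hq i hi
      have h3 := hq j hj
      have h4 := hsinj _ _ (by omega) (by omega) h1
      rcases lt_trichotomy i j with h | h | h
      · have := hqm i j h hj; omega
      · exact h
      · have := hqm j i h hi; omega
    have hPim : P.image f1 = (Finset.range t).image (fun i => f1 (ascNth P i)) := by
      ext k
      simp only [Finset.mem_image, Finset.mem_range]
      constructor
      · rintro ⟨p, hp', rfl⟩
        obtain ⟨i, hi, rfl⟩ := ascNth_surj P p hp'
        exact ⟨i, by omega, rfl⟩
      · rintro ⟨i, hi, rfl⟩
        exact ⟨_, ascNth_mem P i (by omega), rfl⟩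
    have hQim : Q.image f2 = (Finset.range t).image (fun i => f2 (ascNth Q (t - 1 - i))) := by
      ext k
      simp only [Finset.mem_image, Finset.mem_range]
      constructor
      · rintro ⟨p, hp', rfl⟩
        obtain ⟨i, hi, rfl⟩ := ascNth_surj Q p hp'
        refine ⟨t - 1 - i, by omega, ?_⟩
        congr 2
        omega
      · rintro ⟨i, hi, rfl⟩
        exact ⟨_, ascNth_mem Q _ (by omega), rfl⟩
    have hE := pq_term A B (Matrix.of fun k i : Fin (r' + 1) => pqW U r' i (g1 k))
      (Matrix.of fun k i : Fin (r' + 1) => pqW U r' i (g2 (ρ k))) t (fun i => f1 (ascNth P i))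
      (fun i => f2 (ascNth Q (t - 1 - i))) hainj hbinj (P.image f1) (Q.image f2) hPim hQim
      (by
        intro i hi
        ext l
        rw [hB]
        simp only [Matrix.of_apply]
        have h1 := x2 i hi
        simp only [hra i hi, hrb i hi] at h1
        rw [hb i hi, h1, hρa i hi])
      (by
        intro k hk
        ext l
        rw [hA]
        simp only [Matrix.of_apply]
        rw [x3]
        intro i hi h
        apply hk
        rw [hQim]
        refine Finset.mem_image.2 ⟨i, Finset.mem_range.2 hi, Fin.ext ?_⟩
        rw [hb i hi, h, hrb i hi])
      (by
        intro i hi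
        ext l
        rw [hA]
        simp only [Matrix.of_apply]
        have h1 := y2 i hi
        simp only [hra i hi, hrb i hi] at h1
        rw [hb i hi, hρa i hi, h1])
      (by
        intro k hk
        ext l
        rw [hB]
        simp only [Matrix.of_apply]
        rw [y3]
        intro i hi h
        apply hk
        rw [hPim]
        refine Finset.mem_image.2 ⟨i, Finset.mem_range.2 hi, ?_⟩
        apply ρ.injective
        apply Fin.ext
        rw [hρa i hi, h, hra i hi])
    have hd1' : Matrix.det (Matrix.of fun k i : Fin (r' + 1) => pqW U r' i (g1 k)) = pqD U r' g1 := rfl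
    have hd2' : Matrix.det (Matrix.of fun k i : Fin (r' + 1) => pqW U r' i (g2 (ρ k))) =
        (Equiv.Perm.sign ρ : ℤ) * pqD U r' g2 := by
      rw [pqD, ← Matrix.det_permute]
      rfl
    rw [hE, hd1', hd2', x0, y0]
    generalize (∑ i ∈ Finset.range t, _ : ℕ) = w
    have hw : ((((-1 : ℤˣ) ^ w : ℤˣ) : ℤ) : R) * ((((-1 : ℤˣ) ^ w : ℤˣ) : ℤ) : R) = 1 := by
      push_cast
      rw [← mul_pow]; simp
    linear_combination (-((Equiv.Perm.sign ρ : ℤ) : R) * (-1) ^ t * pqD U r' g1 * pqD U r' g2) * hw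
  -- assemble
  have hinj1 : Set.InjOn f1 (Finset.Icc 1 d : Finset ℕ) := by
    intro i hi j hj hij
    simp only [Finset.coe_Icc, Set.mem_Icc] at hi hj
    have h1 : s (i - 1) = s (j - 1) := by
      rw [← hf1 i hi.1 hi.2, ← hf1 j hj.1 hj.2, hij]
    have := hsinj _ _ (by omega) (by omega) h1
    omega
  have hinj2 : Set.InjOn f2 (Finset.Icc d n : Finset ℕ) := by
    intro i hi j hj hij
    simp only [Finset.coe_Icc, Set.mem_Icc] at hi hj
    have h1 : s i = s j := by
      rw [← hf2 i hi.2, ← hf2 j hj.2, hij]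
    exact hsinj _ _ (by omega) (by omega) h1
  rw [sum_powerset_im f1 _ hinj1] at hmain
  have hinner : ∀ P ∈ (Finset.Icc 1 d).powerset,
      ∑ Q ∈ T2.powerset, pqE A B (P.image f1) Q =
        ∑ Q ∈ Finset.powersetCard P.card (Finset.Icc d n), pqE A B (P.image f1) (Q.image f2) := by
    intro P hP
    rw [sum_powerset_im f2 _ hinj2]
    symm
    apply Finset.sum_subset (fun Q hQ => Finset.mem_powerset.2 (Finset.mem_powersetCard.1 hQ).1)
    intro Q hQ hQ'
    apply pq_zero
    rw [Finset.card_image_of_injOn (hinj1.mono (Finset.coe_subset.2 (Finset.mem_powerset.1 hP))),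
      Finset.card_image_of_injOn (hinj2.mono (Finset.coe_subset.2 (Finset.mem_powerset.1 hQ)))]
    intro h
    exact hQ' (Finset.mem_powersetCard.2 ⟨Finset.mem_powerset.1 hQ, h.symm⟩)
  rw [Finset.sum_congr rfl hinner, Finset.sum_powerset] at hmain
  have hgroup : ∀ t ∈ Finset.range ((Finset.Icc 1 d).card + 1),
      ∑ P ∈ Finset.powersetCard t (Finset.Icc 1 d),
        ∑ Q ∈ Finset.powersetCard P.card (Finset.Icc d n), pqE A B (P.image f1) (Q.image f2) =
      (Equiv.Perm.sign ρ : ℤ) * ((-1) ^ t * ∑ P ∈ Finset.powersetCard t (Finset.Icc 1 d),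
        ∑ Q ∈ Finset.powersetCard t (Finset.Icc d n),
          SchurV U (r' + 1)
                  (iterOp AddOp t (fun i => rr (ascNth P i - 1))
                    (fun i => rr (ascNth Q (t - 1 - i) - 1)) lam)
                  (fun _ => 0) *
                SchurV U r'
                  (iterOp RemOp t (fun i => rr (ascNth P i - 1))
                    (fun i => rr (ascNth Q (t - 1 - i) - 1)) lam)
                  (fun _ => 0)) := by
    intro t _
    simp only [Finset.mul_sum]
    refine Finset.sum_congr rfl fun P hP => ?_
    rw [(Finset.mem_powersetCard.1 hP).2]
    exact Finset.sum_congr rfl fun Q hQ => hterm t P hP Q hQ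
  rw [Finset.sum_congr rfl hgroup, ← Finset.mul_sum, hR1, hR2, Nat.card_Icc] at hmain
  have hcancel : ∀ (e : ℤˣ), (((e : ℤˣ) : ℤ) : R) * (((e : ℤˣ) : ℤ) : R) = 1 := by
    intro e
    rw [← Int.cast_mul, ← Units.val_mul, Int.units_mul_self]; simp
  have hsign' : (((Equiv.Perm.sign ρ : ℤˣ) : ℤ) : R) =
      ((Equiv.Perm.sign ρ1 : ℤˣ) : ℤ) * ((Equiv.Perm.sign ρ2 : ℤˣ) : ℤ) := by
    rw [hsign]; push_cast; rfl
  have e0 := hcancel (Equiv.Perm.sign ρ)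
  rw [Finset.sum_range_succ'] at hmain
  have hzero : ((-1 : R) ^ 0 * ∑ P ∈ Finset.powersetCard 0 (Finset.Icc 1 d),
        ∑ Q ∈ Finset.powersetCard 0 (Finset.Icc d n),
          SchurV U (r' + 1)
                  (iterOp AddOp 0 (fun i => rr (ascNth P i - 1))
                    (fun i => rr (ascNth Q (0 - 1 - i) - 1)) lam)
                  (fun _ => 0) *
                SchurV U r'
                  (iterOp RemOp 0 (fun i => rr (ascNth P i - 1))
                    (fun i => rr (ascNth Q (0 - 1 - i) - 1)) lam)
                  (fun _ => 0)) =
      SchurV U (r' + 1) lam (fun _ => 0) * SchurV U r' lam (fun _ => 0) := by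
    simp [iterOp]
  rw [hzero] at hmain
  have hIcc : ∀ G : ℕ → R, (∀ t, n - d + 1 < t → G t = 0) →
      ∑ t ∈ Finset.Icc 1 (min d (n - d + 1)), (-1 : R) ^ (t - 1) * G t =
      - ∑ t ∈ Finset.range (d + 1 - 1), (-1 : R) ^ (t + 1) * G (t + 1) := by
    intro G hG
    rw [← Finset.sum_neg_distrib]
    have h1 : ∑ t ∈ Finset.Icc 1 (min d (n - d + 1)), (-1 : R) ^ (t - 1) * G t =
        ∑ t ∈ Finset.Icc 1 d, (-1 : R) ^ (t - 1) * G t := by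
      apply Finset.sum_subset
      · intro t ht
        simp only [Finset.mem_Icc] at ht ⊢
        omega
      · intro t ht ht'
        simp only [Finset.mem_Icc] at ht ht'
        rw [hG t (by omega), mul_zero]
    rw [h1]
    symm
    refine Finset.sum_bij (fun t _ => t + 1) ?_ ?_ ?_ ?_
    · intro t ht
      simp only [Finset.mem_range, Finset.mem_Icc] at ht ⊢
      omega
    · intro i _ j _ h; omega
    · intro t ht
      simp only [Finset.mem_Icc] at ht
      exact ⟨t - 1, by simp only [Finset.mem_range]; omega, by omega⟩
    · intro t _
      rw [Nat.add_sub_cancel, pow_succ]; ring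
  rw [hIcc]
  · generalize (∑ t ∈ Finset.range (d + 1 - 1), _ : R) = SS at hmain ⊢
    rw [hsign'] at hmain e0
    linear_combination ((Equiv.Perm.sign ρ1 : ℤ) * (Equiv.Perm.sign ρ2 : ℤ) : R) * hmain -
      (SS + SchurV U (r' + 1) lam (fun _ => 0) * SchurV U r' lam (fun _ => 0) -
        SchurV U (r' + 1) (fun i => if i < s d then lam i - 1 else lam i) (fun _ => 0) *
        SchurV U r' (fun i => if i < s d then lam i + 1 else lam i) (fun _ => 0)) * e0
  · intro t ht
    refine Finset.sum_eq_zero fun P _ => ?_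
    rw [Finset.powersetCard_eq_empty.2 (by rw [Nat.card_Icc]; omega), Finset.sum_empty]

theorem stepPart_spec (n : ℕ) (m rr : ℕ → ℕ) (i : ℕ) :
    (∃ j < n, i < rr j ∧ (∀ j' < j, rr j' ≤ i) ∧ stepPart n m rr i = m j) ∨
      ((∀ j < n, rr j ≤ i) ∧ stepPart n m rr i = 0) := by
  unfold stepPart
  split_ifs with h
  · left
    have hmem := Finset.min'_mem _ h
    rw [Finset.mem_filter, Finset.mem_range] at hmem
    refine ⟨_, hmem.1, hmem.2, ?_, rfl⟩
    intro j' hj'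
    by_contra hcon
    have := Finset.min'_le ((Finset.range n).filter fun j => i < rr j) j' (by
      rw [Finset.mem_filter, Finset.mem_range]
      exact ⟨by omega, by omega⟩)
    omega
  · right
    refine ⟨?_, rfl⟩
    intro j hj
    by_contra hcon
    exact h ⟨j, by rw [Finset.mem_filter, Finset.mem_range]; exact ⟨hj, by omega⟩⟩

end PluckerMain
/-- Plücker-type quadratic relation for the ninth variation (Theorem 4.2(1)). -/
theorem plucker_quadratic {R : Type*} [CommRing R] {N : ℕ} (hN : 0 < N)
    (U : Matrix (Fin N) (Fin N) R) (hU : UpperUni U)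
    (n : ℕ) (hn : 1 ≤ n) (m rr : ℕ → ℕ)
    (hm : ∀ j, j + 1 < n → m (j + 1) < m j) (hmpos : 0 < m (n - 1))
    (hrr : ∀ j, j + 1 < n → rr j < rr (j + 1)) (hrrpos : 0 < rr 0)
    (r : ℕ) (hr : rr (n - 1) + 1 ≤ r - 1) (hrN : r ≤ N) (hwid : m 0 + 1 ≤ N - r)
    (d : ℕ) (hd1 : 1 ≤ d) (hdn : d ≤ n) :
    SchurV U r (stepPart n m rr) (fun _ => 0) *
        SchurV U (r - 1) (stepPart n m rr) (fun _ => 0) =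
      SchurV U r
          (fun i => if i < rr (d - 1) then stepPart n m rr i - 1 else stepPart n m rr i)
          (fun _ => 0) *
        SchurV U (r - 1)
          (fun i => if i < rr (d - 1) then stepPart n m rr i + 1 else stepPart n m rr i)
          (fun _ => 0) +
      ∑ t ∈ Finset.Icc 1 (min d (n - d + 1)),
        (-1 : R) ^ (t - 1) *
          ∑ P ∈ Finset.powersetCard t (Finset.Icc 1 d),
            ∑ Q ∈ Finset.powersetCard t (Finset.Icc d n),
              SchurV U r
                  (iterOp AddOp t (fun i => rr (ascNth P i - 1))
                    (fun i => rr (ascNth Q (t - 1 - i) - 1)) (stepPart n m rr))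
                  (fun _ => 0) *
                SchurV U (r - 1)
                  (iterOp RemOp t (fun i => rr (ascNth P i - 1))
                    (fun i => rr (ascNth Q (t - 1 - i) - 1)) (stepPart n m rr))
                  (fun _ => 0) := by
  obtain ⟨r', rfl⟩ : ∃ r', r = r' + 1 := ⟨r - 1, by omega⟩
  rw [Nat.add_sub_cancel] at hr ⊢
  have hrlt : ∀ i j, i < j → j < n → rr i < rr j := by
    intro i j hij
    induction j, hij using Nat.le_induction with
    | base => intro h; exact hrr i h
    | succ j hj ih => intro h; exact (ih (by omega)).trans (hrr j h)
  have hmlt : ∀ i j, i < j → j < n → m j < m i := by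
    intro i j hij
    induction j, hij using Nat.le_induction with
    | base => intro h; exact hm i h
    | succ j hj ih => intro h; exact (hm j h).trans (ih (by omega))
  have hmp : ∀ j < n, 0 < m j := by
    intro j hj
    rcases eq_or_lt_of_le (show j ≤ n - 1 by omega) with h | h
    · rw [h]; exact hmpos
    · exact hmpos.trans (hmlt j (n - 1) h (by omega))
  have hrle : ∀ j < n, rr j ≤ rr (n - 1) := by
    intro j hj
    rcases eq_or_lt_of_le (show j ≤ n - 1 by omega) with h | h
    · rw [h]
    · exact (hrlt j (n - 1) h (by omega)).le
  obtain ⟨s, hs0, hs1, hs2⟩ : ∃ s : ℕ → ℕ, s 0 = 0 ∧ (∀ j < n, s (j + 1) = rr j) ∧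
      s (n + 1) = r' + 1 := by
    refine ⟨fun j => if j = 0 then 0 else if j ≤ n then rr (j - 1) else r' + 1, ?_, ?_, ?_⟩
    · simp
    · intro j hj
      simp only [Nat.add_sub_cancel]
      rw [if_neg (by omega), if_pos (by omega)]
    · simp
  have hsp : ∀ p, 1 ≤ p → p ≤ n → rr (p - 1) = s p := by
    intro p h1 h2
    have := hs1 (p - 1) (by omega)
    rwa [Nat.sub_add_cancel h1, eq_comm] at this
  rw [hsp d hd1 hdn]
  have hzero : stepPart n m rr r' = 0 := by
    rcases stepPart_spec n m rr r' with ⟨j, hj, h1, -, -⟩ | ⟨-, h⟩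
    · have := hrle j hj; omega
    · exact h
  refine main_s U r' n d hd1 hdn (stepPart n m rr) s rr hs0 ?_ hs2 hsp ?_ ?_ ?_ hzero
  · intro j hj
    rcases Nat.eq_zero_or_pos j with rfl | hj0
    · rw [hs0, hs1 0 (by omega)]; exact hrrpos
    · rw [← hsp j hj0 hj]
      rcases eq_or_lt_of_le hj with rfl | hj'
      · rw [hs2]; omega
      · rw [hs1 j hj']; exact hrlt _ _ (by omega) hj'
  · intro i j hij
    rcases stepPart_spec n m rr i with ⟨a, ha, h1, h2, h3⟩ | ⟨h1, h3⟩
    · rcases stepPart_spec n m rr j with ⟨b, hb, g1, g2, g3⟩ | ⟨g1, g3⟩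
      · rw [h3, g3]
        rcases lt_trichotomy a b with h | h | h
        · exact (hmlt a b h hb).le
        · rw [h]
        · have := h2 b h; omega
      · rw [g3]; omega
    · rcases stepPart_spec n m rr j with ⟨b, hb, g1, g2, g3⟩ | ⟨g1, g3⟩
      · have := h1 b hb; omega
      · rw [g3]; omega
  · intro k hk hne
    have hk0 : k ≠ 0 := by
      have := hne 0 (by omega)
      rwa [hs0] at this
    have hkj : ∀ j < n, k ≠ rr j := by
      intro j hj
      have := hne (j + 1) (by omega)
      rwa [hs1 j hj] at this
    rcases stepPart_spec n m rr k with ⟨a, ha, h1, h2, h3⟩ | ⟨h1, h3⟩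
    · rcases stepPart_spec n m rr (k - 1) with ⟨b, hb, g1, g2, g3⟩ | ⟨g1, g3⟩
      · rw [h3, g3]
        rcases lt_trichotomy a b with h | h | h
        · have := g2 a h; omega
        · rw [h]
        · have := h2 b h
          have := hkj b hb
          omega
      · have := g1 a ha; omega
    · rcases stepPart_spec n m rr (k - 1) with ⟨b, hb, g1, g2, g3⟩ | ⟨g1, g3⟩
      · have := h1 b hb
        have := hkj b hb
        omega
      · rw [h3, g3]
  · intro j hj1 hj2
    rw [← hsp j hj1 hj2]
    have hpos : 0 < rr (j - 1) := by
      rcases Nat.eq_zero_or_pos (j - 1) with h | h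
      · rw [h]; exact hrrpos
      · exact hrrpos.trans (hrlt 0 (j - 1) h (by omega))
    have e1 : stepPart n m rr (rr (j - 1) - 1) = m (j - 1) := by
      rcases stepPart_spec n m rr (rr (j - 1) - 1) with ⟨b, hb, g1, g2, g3⟩ | ⟨g1, g3⟩
      · rw [g3]
        rcases lt_trichotomy b (j - 1) with h | h | h
        · have := hrlt b (j - 1) h (by omega); omega
        · rw [h]
        · have := g2 _ h; omega
      · have := g1 (j - 1) (by omega); omega
    rw [e1]
    rcases stepPart_spec n m rr (rr (j - 1)) with ⟨b, hb, g1, g2, g3⟩ | ⟨g1, g3⟩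
    · rw [g3]
      apply hmlt _ _ _ hb
      by_contra hcon
      rcases eq_or_lt_of_le (not_lt.1 hcon) with h | h
      · rw [h] at g1; omega
      · have := hrlt b (j - 1) h (by omega); omega
    · rw [g3]; exact hmp _ (by omega)
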